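/- Consider a Markov chain on the path {0,1,...,d} with loop probabilities α_i ≥ 1/2 at each node, upward probability β_i > 0 at node i<d, and downward probability 1-α_i-β_i. Then the first-passage time distribution f_{0,d}(t) from node 0 to node d equals the convolution of d independent geometric distributions with parameters in (0,1). -/

import Mathlib

/-- Transition matrix of a random walk on the path `0,1,...,d`: loop probability
`α i` at node `i`, upward probability `β i`, downward probability `1 - α i - β i`. -/
def pathP (d : ℕ) (α β : ℕ → ℝ) : Matrix (Fin (d + 1)) (Fin (d + 1)) ℝ :=
  fun i j =>
    if j.val = i.val then α i.val
    else if j.val = i.val + 1 then β i.val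
    else if j.val + 1 = i.val then 1 - α i.val - β i.val
    else 0

/-- The walk killed upon reaching node `d`. -/
def pathQ (d : ℕ) (α β : ℕ → ℝ) : Matrix (Fin (d + 1)) (Fin (d + 1)) ℝ :=
  fun i j => if j = Fin.last d then 0 else pathP d α β i j

/-- First-passage probabilities from node `0` to node `d`:
`firstPassage d α β t` is the probability that the walk started at `0` first
visits `d` exactly at time `t`. -/
noncomputable def firstPassage (d : ℕ) (α β : ℕ → ℝ) : ℕ → ℝ
  | 0 => 0
  | (t + 1) => ∑ j, (pathQ d α β ^ t) 0 j * pathP d α β j (Fin.last d)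

/-- The geometric distribution with parameter `p`. -/
noncomputable def Geo (p : ℝ) : ℕ → ℝ
  | 0 => 0
  | (t + 1) => (1 - p) ^ t * p

/-- The convolution `(f*g)(k) = ∑_{i=0}^k f i * g (k-i)`. -/
def conv (f g : ℕ → ℝ) : ℕ → ℝ :=
  fun k => ∑ i ∈ Finset.range (k + 1), f i * g (k - i)

/-- The Dirac mass at `0`, the identity for convolution. -/
def deltaZero : ℕ → ℝ := fun k => if k = 0 then 1 else 0

section JacobiPoly

open Polynomial

/-- The monic polynomials of a Jacobi recurrence with diagonal coefficients `a` and
products of opposite off-diagonal coefficients `c`. -/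
noncomputable def jacobiPoly (a c : ℕ → ℝ) : ℕ → ℝ[X]
  | 0 => 1
  | 1 => X - C (a 0)
  | (n + 2) => (X - C (a (n + 1))) * jacobiPoly a c (n + 1) - C (c n) * jacobiPoly a c n

/-- The reciprocal polynomials of `jacobiPoly`. -/
noncomputable def jacobiRev (a c : ℕ → ℝ) : ℕ → ℝ[X]
  | 0 => 1
  | 1 => 1 - C (a 0) * X
  | (n + 2) => (1 - C (a (n + 1)) * X) * jacobiRev a c (n + 1)
      - C (c n) * X ^ 2 * jacobiRev a c n

lemma jacobiPoly_monic_natDegree (a c : ℕ → ℝ) (n : ℕ) :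
    ((jacobiPoly a c n).Monic ∧ (jacobiPoly a c n).natDegree = n) ∧
      ((jacobiPoly a c (n + 1)).Monic ∧ (jacobiPoly a c (n + 1)).natDegree = n + 1) := by
  induction n with
  | zero => simp [jacobiPoly, monic_X_sub_C]
  | succ n ih =>
    refine ⟨ih.2, ?_⟩
    obtain ⟨⟨h1, h2⟩, h3, h4⟩ := ih
    have hm : ((X - C (a (n + 1))) * jacobiPoly a c (n + 1)).Monic := (monic_X_sub_C _).mul h3
    have hd : ((X - C (a (n + 1))) * jacobiPoly a c (n + 1)).natDegree = n + 2 := by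
      rw [(monic_X_sub_C _).natDegree_mul h3, natDegree_X_sub_C, h4]; ring
    have hlt : (C (c n) * jacobiPoly a c n).natDegree <
        ((X - C (a (n + 1))) * jacobiPoly a c (n + 1)).natDegree := by
      refine (natDegree_C_mul_le _ _).trans_lt ?_
      omega
    have hlt' := degree_lt_degree hlt
    exact ⟨hm.sub_of_left hlt', by rw [jacobiPoly, natDegree_sub_eq_left_of_natDegree_lt hlt, hd]⟩

lemma eval_jacobiRev (a c : ℕ → ℝ) {x : ℝ} (hx : x ≠ 0) (n : ℕ) :
    (jacobiRev a c n).eval x = x ^ n * (jacobiPoly a c n).eval x⁻¹ ∧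
      (jacobiRev a c (n + 1)).eval x = x ^ (n + 1) * (jacobiPoly a c (n + 1)).eval x⁻¹ := by
  induction n with
  | zero =>
    simp only [jacobiRev, jacobiPoly, eval_one, eval_sub, eval_mul, eval_C, eval_X]
    constructor
    · simp
    · linear_combination -mul_inv_cancel₀ hx
  | succ n ih =>
    refine ⟨ih.2, ?_⟩
    simp only [jacobiRev, jacobiPoly, eval_one, eval_sub, eval_mul, eval_C, eval_X, eval_pow,
      ih.1, ih.2]
    linear_combination
      -x ^ (n + 1) * (jacobiPoly a c (n + 1)).eval x⁻¹ * mul_inv_cancel₀ hx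

/-- A nonreal point is not a root of a Jacobi polynomial with nonnegative coefficients `c`. -/
lemma jacobiPoly_im_pos (a c : ℕ → ℝ) (d : ℕ) (hc : ∀ n, n + 1 < d → 0 ≤ c n) {z : ℂ}
    (hz : z.im ≠ 0) (n : ℕ) (hn : n + 1 ≤ d) :
    0 < z.im * (aeval z (jacobiPoly a c (n + 1)) *
      (starRingEnd ℂ) (aeval z (jacobiPoly a c n))).im := by
  induction n with
  | zero =>
    simp only [jacobiPoly, map_sub, aeval_X, aeval_C, map_one, mul_one, Complex.sub_im]
    simpa using mul_self_pos.2 hz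
  | succ n ih =>
    have ih := ih (by omega)
    have hcn := hc n (by omega)
    rw [jacobiPoly]
    simp only [map_sub, map_mul, aeval_X, aeval_C]
    generalize aeval z (jacobiPoly a c (n + 1)) = u at *
    generalize aeval z (jacobiPoly a c n) = v at *
    have hu : 0 < u.re ^ 2 + u.im ^ 2 := by
      by_contra! h
      have h1 : u.re = 0 := by nlinarith [sq_nonneg u.re, sq_nonneg u.im]
      have h2 : u.im = 0 := by nlinarith [sq_nonneg u.re, sq_nonneg u.im]
      simp [h1, h2] at ih
    have key := add_pos_of_pos_of_nonneg (mul_pos (mul_self_pos.2 hz) hu)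
      (mul_nonneg hcn ih.le)
    simp only [Complex.mul_im, Complex.mul_re, Complex.sub_im, Complex.sub_re, Complex.conj_re,
      Complex.conj_im, Complex.coe_algebraMap, Complex.ofReal_re, Complex.ofReal_im] at key ⊢
    linear_combination key

lemma jacobiPoly_splits (a c : ℕ → ℝ) (d : ℕ) (hc : ∀ n, n + 1 < d → 0 ≤ c n) :
    (jacobiPoly a c d).Splits := by
  refine Splits.of_splits_map (algebraMap ℝ ℂ) (IsAlgClosed.splits _) fun z hz => ?_
  by_cases h : z.im = 0
  · exact ⟨z.re, Complex.ext (by simp) (by simp [h])⟩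
  · exfalso
    have h0 : aeval z (jacobiPoly a c d) = 0 := by
      have := isRoot_of_mem_roots hz
      rwa [IsRoot, eval_map_algebraMap] at this
    cases d with
    | zero => simp [jacobiPoly] at h0
    | succ n =>
      have := jacobiPoly_im_pos a c (n + 1) hc h n le_rfl
      simp [h0] at this

lemma Polynomial.Splits.exists_fin_prod {f : ℝ[X]} (hf : f.Splits) (hm : f.Monic) :
    ∃ r : Fin f.natDegree → ℝ, f = ∏ i, (X - C (r i)) := by
  have hl : f.roots.toList.length = f.natDegree := by
    rw [Multiset.length_toList, hf.natDegree_eq_card_roots]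
  rw [← hl]
  refine ⟨f.roots.toList.get, ?_⟩
  rw [← List.prod_ofFn]
  conv_lhs => rw [hf.eq_prod_roots_of_monic hm, ← f.roots.coe_toList]
  rw [Multiset.map_coe, Multiset.prod_coe]
  congr 1
  apply List.ext_get <;> simp

lemma exists_jacobiPoly_eq_prod (a c : ℕ → ℝ) (d : ℕ) (hc : ∀ n, n + 1 < d → 0 ≤ c n) :
    ∃ r : Fin d → ℝ, jacobiPoly a c d = ∏ i, (X - C (r i)) := by
  obtain ⟨hm, hd⟩ := (jacobiPoly_monic_natDegree a c d).1
  have := (jacobiPoly_splits a c d hc).exists_fin_prod hm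
  rwa [hd] at this

lemma jacobiRev_eq_prod {a c : ℕ → ℝ} {d : ℕ} {r : Fin d → ℝ}
    (h : jacobiPoly a c d = ∏ i, (X - C (r i))) :
    jacobiRev a c d = ∏ i, (1 - C (r i) * X) := by
  refine eq_of_infinite_eval_eq _ _ ((Set.finite_singleton (0 : ℝ)).infinite_compl.mono ?_)
  intro x hx
  have hx : x ≠ 0 := hx
  simp only [Set.mem_ofPred_eq, (eval_jacobiRev a c hx d).1, h, eval_prod, eval_sub, eval_X,
    eval_C, eval_one, eval_mul]
  have : x ^ d = ∏ _i : Fin d, x := by simp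
  rw [this, ← Finset.prod_mul_distrib]
  exact Finset.prod_congr rfl fun i _ => by field_simp

end JacobiPoly

section Bounds

variable {d : ℕ} {α β : ℕ → ℝ}

/-- The characteristic polynomial of the walk on `0, ..., n - 1` killed at `n`. -/
noncomputable abbrev pathPoly (α β : ℕ → ℝ) (n : ℕ) : Polynomial ℝ :=
  jacobiPoly α (fun i => (1 - α (i + 1) - β (i + 1)) * β i) n

lemma pathPoly_eval_one (h0 : α 0 + β 0 = 1) (n : ℕ) :
    (pathPoly α β (n + 1)).eval 1 = β n * (pathPoly α β n).eval 1 := by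
  induction n with
  | zero => simp only [pathPoly, jacobiPoly, Polynomial.eval_sub, Polynomial.eval_X,
      Polynomial.eval_C, Polynomial.eval_one]; linarith
  | succ n ih =>
    rw [pathPoly, jacobiPoly]
    simp only [Polynomial.eval_sub, Polynomial.eval_X, Polynomial.eval_C, Polynomial.eval_mul]
    linear_combination (1 - α (n + 1) - β (n + 1)) * ih

lemma pathPoly_eval_pos (hβ : ∀ i < d, 0 < β i) (hsum : ∀ i ≤ d, α i + β i ≤ 1)
    {x : ℝ} (hx : 1 ≤ x) (n : ℕ) (hn : n + 1 ≤ d) :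
    0 < (pathPoly α β n).eval x ∧
      β n * (pathPoly α β n).eval x ≤ (pathPoly α β (n + 1)).eval x := by
  induction n with
  | zero =>
    simp only [pathPoly, jacobiPoly, Polynomial.eval_sub, Polynomial.eval_X,
      Polynomial.eval_C, Polynomial.eval_one]
    exact ⟨one_pos, by linarith [hsum 0 (by omega)]⟩
  | succ n ih =>
    obtain ⟨h1, h2⟩ := ih (by omega)
    have hpos : 0 < (pathPoly α β (n + 1)).eval x := (mul_pos (hβ n (by omega)) h1).trans_le h2
    refine ⟨hpos, ?_⟩
    have hs := hsum (n + 1) (by omega)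
    rw [pathPoly, pathPoly, jacobiPoly]
    simp only [Polynomial.eval_sub, Polynomial.eval_X, Polynomial.eval_C, Polynomial.eval_mul]
    have e1 := mul_le_mul_of_nonneg_left h2 (by linarith : 0 ≤ 1 - α (n + 1) - β (n + 1))
    have e2 := mul_le_mul_of_nonneg_right hx hpos.le
    simp only [pathPoly] at e1 e2
    linarith

lemma pathPoly_eval_neg (hα : ∀ i ≤ d, (1 : ℝ) / 2 ≤ α i) (hβ : ∀ i < d, 0 < β i)
    (hsum : ∀ i ≤ d, α i + β i ≤ 1)
    {x : ℝ} (hx : x ≤ 0) (n : ℕ) (hn : n + 1 ≤ d) :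
    0 < (-1) ^ n * (pathPoly α β n).eval x ∧
      β n * ((-1) ^ n * (pathPoly α β n).eval x) ≤
        (-1) ^ (n + 1) * (pathPoly α β (n + 1)).eval x := by
  induction n with
  | zero =>
    simp only [pathPoly, jacobiPoly, Polynomial.eval_sub, Polynomial.eval_X,
      Polynomial.eval_C, Polynomial.eval_one]
    exact ⟨by norm_num, by norm_num; linarith [hsum 0 (by omega), hα 0 (by omega)]⟩
  | succ n ih =>
    obtain ⟨h1, h2⟩ := ih (by omega)
    have hpos : 0 < (-1) ^ (n + 1) * (pathPoly α β (n + 1)).eval x :=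
      (mul_pos (hβ n (by omega)) h1).trans_le h2
    refine ⟨hpos, ?_⟩
    have hs := hsum (n + 1) (by omega)
    have ha := hα (n + 1) (by omega)
    have hrec : (-1) ^ (n + 1 + 1) * (pathPoly α β (n + 1 + 1)).eval x =
        (α (n + 1) - x) * ((-1) ^ (n + 1) * (pathPoly α β (n + 1)).eval x) -
          (1 - α (n + 1) - β (n + 1)) * (β n * ((-1) ^ n * (pathPoly α β n).eval x)) := by
      rw [pathPoly, jacobiPoly]
      simp only [Polynomial.eval_sub, Polynomial.eval_X, Polynomial.eval_C, Polynomial.eval_mul]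
      ring
    rw [hrec]
    have e1 := mul_le_mul_of_nonneg_left h2 (by linarith : 0 ≤ 1 - α (n + 1) - β (n + 1))
    have e2 := mul_le_mul_of_nonneg_right
      (by linarith : 1 - α (n + 1) ≤ α (n + 1) - x) hpos.le
    linarith

lemma pathPoly_root_mem_Ioo (hd : 1 ≤ d) (hα : ∀ i ≤ d, (1 : ℝ) / 2 ≤ α i)
    (hβ : ∀ i < d, 0 < β i) (hsum : ∀ i ≤ d, α i + β i ≤ 1) {x : ℝ}
    (hx : (pathPoly α β d).eval x = 0) : x ∈ Set.Ioo (0 : ℝ) 1 := by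
  obtain ⟨n, rfl⟩ := Nat.exists_eq_add_of_le' hd
  constructor
  · by_contra! h
    obtain ⟨h1, h2⟩ := pathPoly_eval_neg hα hβ hsum h n le_rfl
    have := mul_pos (hβ n (by omega)) h1
    rw [hx] at h2
    linarith
  · by_contra! h
    obtain ⟨h1, h2⟩ := pathPoly_eval_pos hβ hsum h n le_rfl
    have := mul_pos (hβ n (by omega)) h1
    rw [hx] at h2
    linarith

end Bounds

section GeneratingFunctions

open PowerSeries

lemma mk_conv (f g : ℕ → ℝ) : mk (conv f g) = mk f * mk g := by
  ext n
  rw [coeff_mul, Finset.Nat.sum_antidiagonal_eq_sum_range_succ_mk]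
  simp [conv]

lemma mk_foldr_conv (l : List (ℕ → ℝ)) :
    mk (l.foldr conv deltaZero) = (l.map mk).prod := by
  induction l with
  | nil =>
    ext n
    simp [deltaZero, coeff_one]
  | cons f l ih => simp [mk_conv, ih]

lemma one_sub_mul_mk_Geo (r : ℝ) : (1 - C r * X) * mk (Geo (1 - r)) = C (1 - r) * X := by
  ext n
  rw [sub_mul, one_mul, mul_assoc, map_sub, coeff_C_mul, coeff_C_mul]
  rcases n with _ | _ | n
  · simp [Geo]
  · simp [coeff_succ_X_mul, Geo]
  · rw [coeff_succ_X_mul, coeff_X]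
    simp [Geo, pow_succ]
    ring

variable (d : ℕ) (α β : ℕ → ℝ)

/-- The probability that the walk started at `0` and killed at `d` is at `j` at time `t`. -/
def killedProb (t j : ℕ) : ℝ :=
  if h : j < d + 1 then (pathQ d α β ^ t) 0 ⟨j, h⟩ else 0

lemma killedProb_zero (j : ℕ) : killedProb d α β 0 j = if j = 0 then 1 else 0 := by
  unfold killedProb
  rcases j with _ | j
  · simp
  · simp [Fin.ext_iff]

lemma killedProb_self (hd : 1 ≤ d) (t : ℕ) : killedProb d α β t d = 0 := by
  rcases t with _ | t
  · rw [killedProb_zero, if_neg (by omega)]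
  · have : (⟨d, Nat.lt_succ_self d⟩ : Fin (d + 1)) = Fin.last d := rfl
    simp [killedProb, pow_succ, Matrix.mul_apply, pathQ, this]

lemma sum_pow_pathQ_mul (t : ℕ) (j : Fin (d + 1)) :
    ∑ i, (pathQ d α β ^ t) 0 i * pathP d α β i j =
      (if j.val = 0 then 0 else β (j - 1) * killedProb d α β t (j - 1)) +
        α j * killedProb d α β t j +
        (1 - α (j + 1) - β (j + 1)) * killedProb d α β t (j + 1) := by
  have h : ∀ i : Fin (d + 1), (pathQ d α β ^ t) 0 i * pathP d α β i j =
      (fun i : ℕ => (if i + 1 = j then β i * killedProb d α β t i else 0) +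
        (if i = j then α i * killedProb d α β t i else 0) +
        (if i = j + 1 then (1 - α i - β i) * killedProb d α β t i else 0)) i := by
    intro i
    have hk : killedProb d α β t i = (pathQ d α β ^ t) 0 i := dif_pos i.isLt
    simp only [hk, pathP]
    split_ifs <;> first | omega | ring
  rw [Finset.sum_congr rfl fun i _ => h i, Fin.sum_univ_eq_sum_range
    (fun i : ℕ => (if i + 1 = j then β i * killedProb d α β t i else 0) +
        (if i = j then α i * killedProb d α β t i else 0) +
        (if i = j + 1 then (1 - α i - β i) * killedProb d α β t i else 0)),
    Finset.sum_add_distrib, Finset.sum_add_distrib]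
  have hj := j.isLt
  congr 1
  · congr 1
    · split_ifs with h0
      · exact Finset.sum_eq_zero fun i _ => if_neg (by omega)
      · rw [Finset.sum_eq_single (j.val - 1)]
        · rw [if_pos (by omega)]
        · intro b _ hb
          exact if_neg (by omega)
        · intro hb
          rw [Finset.mem_range] at hb
          omega
    · rw [Finset.sum_ite_eq', if_pos (Finset.mem_range.2 hj)]
  · rw [Finset.sum_ite_eq']
    split_ifs with h1
    · rfl
    · rw [Finset.mem_range] at h1
      simp [killedProb, h1]

lemma killedProb_succ (t j : ℕ) (hj : j < d) :
    killedProb d α β (t + 1) j =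
      (if j = 0 then 0 else β (j - 1) * killedProb d α β t (j - 1)) +
        α j * killedProb d α β t j +
        (1 - α (j + 1) - β (j + 1)) * killedProb d α β t (j + 1) := by
  rw [← sum_pow_pathQ_mul d α β t ⟨j, by omega⟩, killedProb, dif_pos (by omega), pow_succ,
    Matrix.mul_apply]
  refine Finset.sum_congr rfl fun i _ => ?_
  rw [pathQ, if_neg]
  simp only [Fin.ext_iff, Fin.val_last]
  omega

lemma firstPassage_succ (n t : ℕ) :
    firstPassage (n + 1) α β (t + 1) = β n * killedProb (n + 1) α β t n := by
  rw [firstPassage, sum_pow_pathQ_mul]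
  have h : killedProb (n + 1) α β t (n + 1 + 1) = 0 := dif_neg (lt_irrefl _)
  simp [killedProb_self, h]

/-- The generating function of the visits to `j` of the walk killed at `d`. -/
def greenSeries (j : ℕ) : ℝ⟦X⟧ := mk fun t => killedProb d α β t j

lemma mk_firstPassage (n : ℕ) :
    mk (firstPassage (n + 1) α β) = C (β n) * X * greenSeries (n + 1) α β n := by
  ext t
  rw [mul_assoc, coeff_C_mul]
  rcases t with _ | t
  · simp [firstPassage]
  · simp [coeff_succ_X_mul, firstPassage_succ, greenSeries]

lemma greenSeries_zero (hd : 1 ≤ d) :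
    greenSeries d α β 0 = 1 + X * (C (α 0) * greenSeries d α β 0 +
      C (1 - α 1 - β 1) * greenSeries d α β 1) := by
  ext t
  rcases t with _ | t
  · simp [greenSeries, killedProb_zero]
  · simp [coeff_succ_X_mul, greenSeries, killedProb_succ d α β t 0 hd, coeff_one,
      -map_sub]

lemma greenSeries_succ (j : ℕ) (hj : j + 1 < d) :
    greenSeries d α β (j + 1) = X * (C (β j) * greenSeries d α β j +
      C (α (j + 1)) * greenSeries d α β (j + 1) +
      C (1 - α (j + 2) - β (j + 2)) * greenSeries d α β (j + 2)) := by
  ext t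
  rcases t with _ | t
  · simp [greenSeries, killedProb_zero]
  · simp [coeff_succ_X_mul, greenSeries, killedProb_succ d α β t (j + 1) hj,
      -map_sub]

/-- The reciprocal of the polynomial `pathPoly`. -/
noncomputable abbrev pathRev (n : ℕ) : Polynomial ℝ :=
  jacobiRev α (fun i => (1 - α (i + 1) - β (i + 1)) * β i) n

lemma pathRev_mul_greenSeries (j : ℕ) (hj : j < d) :
    (pathRev α β (j + 1) : ℝ⟦X⟧) * greenSeries d α β j =
      C (∏ i ∈ Finset.range j, β i) * X ^ j +
        X * C (1 - α (j + 1) - β (j + 1)) * greenSeries d α β (j + 1) *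
          (pathRev α β j : ℝ⟦X⟧) := by
  induction j with
  | zero =>
    simp only [pathRev, jacobiRev, Polynomial.coe_sub, Polynomial.coe_mul, Polynomial.coe_one,
      Polynomial.coe_C, Polynomial.coe_X, Finset.prod_range_zero, map_one]
    linear_combination greenSeries_zero d α β hj
  | succ j ih =>
    have ih := ih (by omega)
    have hs := greenSeries_succ d α β j hj
    have hrec : (pathRev α β (j + 2) : ℝ⟦X⟧) =
        (1 - C (α (j + 1)) * X) * (pathRev α β (j + 1) : ℝ⟦X⟧) -
          C (1 - α (j + 1) - β (j + 1)) * C (β j) * X ^ 2 * (pathRev α β j : ℝ⟦X⟧) := by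
      rw [pathRev, jacobiRev]
      simp only [Polynomial.coe_sub, Polynomial.coe_mul, Polynomial.coe_one,
        Polynomial.coe_C, Polynomial.coe_X, Polynomial.coe_pow, map_mul]
    rw [hrec, Finset.prod_range_succ, map_mul]
    linear_combination (pathRev α β (j + 1) : ℝ⟦X⟧) * hs + X * C (β j) * ih

lemma pathRev_mul_mk_firstPassage (hd : 1 ≤ d) :
    (pathRev α β d : ℝ⟦X⟧) * mk (firstPassage d α β) =
      C (∏ i ∈ Finset.range d, β i) * X ^ d := by
  obtain ⟨n, rfl⟩ := Nat.exists_eq_add_of_le' hd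
  have h := pathRev_mul_greenSeries (n + 1) α β n (by omega)
  have h0 : greenSeries (n + 1) α β (n + 1) = 0 := by
    ext t
    simp [greenSeries, killedProb_self]
  rw [h0] at h
  rw [mk_firstPassage, Finset.prod_range_succ, map_mul]
  linear_combination C (β n) * X * h

end GeneratingFunctions

/-- If all loop probabilities satisfy `α i ≥ 1/2` and the upward probabilities are
positive, then the first-passage distribution from `0` to `d` is the convolution of
`d` independent geometric distributions with parameters in `(0,1)`. -/
theorem firstPassage_eq_conv_geometrics (d : ℕ) (hd : 1 ≤ d) (α β : ℕ → ℝ)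
    (hα : ∀ i ≤ d, (1 : ℝ) / 2 ≤ α i)
    (hβ : ∀ i < d, 0 < β i)
    (hβd : β d = 0)
    (hsum : ∀ i ≤ d, α i + β i ≤ 1)
    (h0 : α 0 + β 0 = 1) :
    ∃ p : Fin d → ℝ, (∀ i, p i ∈ Set.Ioo (0 : ℝ) 1) ∧
      ∀ t, firstPassage d α β t =
        ((List.ofFn fun i : Fin d => Geo (p i)).foldr conv deltaZero) t := by
  obtain ⟨r, hr⟩ := exists_jacobiPoly_eq_prod α
    (fun i => (1 - α (i + 1) - β (i + 1)) * β i) d fun n hn =>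
      mul_nonneg (by linarith [hsum (n + 1) (by omega)]) (hβ n (by omega)).le
  refine ⟨fun i => 1 - r i, fun i => ?_, ?_⟩
  · have hi : r i ∈ Set.Ioo (0 : ℝ) 1 := by
      refine pathPoly_root_mem_Ioo hd hα hβ hsum ?_
      rw [pathPoly, hr, Polynomial.eval_prod]
      exact Finset.prod_eq_zero (Finset.mem_univ i) (by simp)
    exact ⟨by linarith [hi.2], by linarith [hi.1]⟩
  have hprod : ∏ i, (1 - r i) = ∏ i ∈ Finset.range d, β i := by
    have h1 : (pathPoly α β d).eval 1 = ∏ i, (1 - r i) := by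
      rw [pathPoly, hr]
      simp [Polynomial.eval_prod]
    rw [← h1]
    clear * - h0
    induction d with
    | zero => simp [pathPoly, jacobiPoly]
    | succ n ih => rw [pathPoly_eval_one h0, ih, Finset.prod_range_succ, mul_comm]
  have hrev : (pathRev α β d : PowerSeries ℝ) =
      ∏ i, (1 - PowerSeries.C (r i) * PowerSeries.X) := by
    rw [pathRev, jacobiRev_eq_prod hr, ← Polynomial.coeToPowerSeries.ringHom_apply, map_prod]
    simp
  have hne : (pathRev α β d : PowerSeries ℝ) ≠ 0 := by
    intro h
    have := congrArg PowerSeries.constantCoeff (hrev.symm.trans h)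
    simp [map_prod] at this
  have hmk : PowerSeries.mk (firstPassage d α β) =
      PowerSeries.mk ((List.ofFn fun i : Fin d => Geo (1 - r i)).foldr conv deltaZero) := by
    apply mul_left_cancel₀ hne
    rw [pathRev_mul_mk_firstPassage d α β hd, mk_foldr_conv, List.map_ofFn, List.prod_ofFn, hrev,
      ← Finset.prod_mul_distrib]
    simp only [Function.comp_apply, one_sub_mul_mk_Geo]
    rw [Finset.prod_mul_distrib, ← map_prod, hprod]
    simp
  intro t
  simpa using congrArg (PowerSeries.coeff t) hmk
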